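/- For all integers n ≥ 1 and k ≥ 1: c(n,k) = 0 if n ≤ k − 1; c(n,k) = 2 if n = k or n = k + 1; and for n ≥ k + 2, c(n,k) = 2·c(n−1,k) + [k ∣ n]·(p'(n/k, k−1) + q(n/k, k−2)) − [(k+1) ∣ n]·(p'(n/(k+1), k) + q(n/(k+1), k−1)), where the Iverson bracket [R] is 1 if the relation R is true and 0 otherwise, and where p'(m,0) = 0 and q(m,j) = 0 for j ≤ 0. -/

import Mathlib

/-- `listPow Y k` is the sequence `Y` repeated `k` times (i.e. `Y^k`). -/
def listPow {α : Type*} (Y : List α) : ℕ → List α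
  | 0 => []
  | k + 1 => Y ++ listPow Y k

/-- The curling number of a finite sequence `S`: the largest `k` such that
`S = X ++ Y^k` for some (possibly empty) `X` and nonempty `Y`. -/
noncomputable def CN {α : Type*} (S : List α) : ℕ :=
  sSup {k | ∃ X Y : List α, Y ≠ [] ∧ S = X ++ listPow Y k}

/-- A nonempty sequence is primitive if it is not a power `T^i` with `i ≥ 2`. -/
def Primitive {α : Type*} (S : List α) : Prop :=
  S ≠ [] ∧ ∀ (T : List α) (i : ℕ), 2 ≤ i → S ≠ listPow T i

/-- `T` is a proper suffix of `S`: a suffix which is strictly shorter than `S`. -/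
def ProperSuffix {α : Type*} (T S : List α) : Prop := T <:+ S ∧ T.length < S.length

/-- A sequence `S` with curling number `k` is robust if no proper suffix of
`S^(k+1)` has curling number `≥ k + 1`. -/
def Robust {α : Type*} (S : List α) : Prop :=
  ∀ T : List α, ProperSuffix T (listPow S (CN S + 1)) → CN T ≤ CN S

/-- `c(n,k)`: the number of binary sequences of length `n` with curling number `k`. -/
noncomputable def cCount (n k : ℕ) : ℕ :=
  {S : List Bool | S.length = n ∧ CN S = k}.ncard

/-- `p(n,k)`: the number of primitive binary sequences of length `n` with curling number `k`. -/
noncomputable def pCount (n k : ℕ) : ℕ :=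
  {S : List Bool | S.length = n ∧ CN S = k ∧ Primitive S}.ncard

/-- `p'(n,k)`: the number of primitive robust binary sequences of length `n`
with curling number `k`. -/
noncomputable def pCount' (n k : ℕ) : ℕ :=
  {S : List Bool | S.length = n ∧ CN S = k ∧ Primitive S ∧ Robust S}.ncard

/-- `q(n,k) = Σ_{i=1}^{k} p(n,i)`. -/
noncomputable def qCount (n k : ℕ) : ℕ := ∑ i ∈ Finset.Icc 1 k, pCount n i

/-- `S^{[i]}`: the suffix of `S` of length `i`. -/
def suffLen {α : Type*} (S : List α) (i : ℕ) : List α := S.drop (S.length - i)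

/-- `A(n,i)`: binary sequences `S` of length `n` with `CN S = 1` and `CN (S^{[i]} S) = 1`. -/
def setA (n i : ℕ) : Set (List Bool) :=
  {S | S.length = n ∧ CN S = 1 ∧ CN (suffLen S i ++ S) = 1}

/-- `B(n,i)`: binary sequences `S` of length `n` with `CN S = 1` and `CN (S S^{[i]} S) = 1`. -/
def setB (n i : ℕ) : Set (List Bool) :=
  {S | S.length = n ∧ CN S = 1 ∧ CN (S ++ suffLen S i ++ S) = 1}

/-- `E(n,i,j)`: binary sequences `S` of length `n` with `CN S = 1`
and `S^{[i]} S ∈ B(n+i, j)`. -/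
def setE (n i j : ℕ) : Set (List Bool) :=
  {S | S.length = n ∧ CN S = 1 ∧ (suffLen S i ++ S) ∈ setB (n + i) j}

noncomputable def aCount (n i : ℕ) : ℕ := (setA n i).ncard
noncomputable def bCount (n i : ℕ) : ℕ := (setB n i).ncard
noncomputable def eCount (n i j : ℕ) : ℕ := (setE n i j).ncard

section ListPow

variable {α : Type*}

theorem length_listPow (Y : List α) (k : ℕ) : (listPow Y k).length = k * Y.length := by
  induction k with
  | zero => simp [listPow]
  | succ k ih => simp [listPow, ih]; ring

theorem listPow_add (Y : List α) (i j : ℕ) :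
    listPow Y (i + j) = listPow Y i ++ listPow Y j := by
  induction i with
  | zero => simp [listPow]
  | succ i ih => rw [Nat.succ_add]; simp [listPow, ih]

theorem listPow_one (Y : List α) : listPow Y 1 = Y := by simp [listPow]

theorem listPow_succ' (Y : List α) (k : ℕ) : listPow Y (k + 1) = listPow Y k ++ Y := by
  rw [listPow_add, listPow_one]

theorem listPow_mul (Y : List α) (i j : ℕ) : listPow Y (i * j) = listPow (listPow Y i) j := by
  induction j with
  | zero => simp [listPow]
  | succ j ih => rw [Nat.mul_succ, listPow_add, ih, listPow_succ']

theorem listPow_injOn {m k : ℕ} (hk : 1 ≤ k) :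
    Set.InjOn (fun Y : List α => listPow Y k) {Y | Y.length = m} := by
  intro Y hY Z hZ h
  obtain ⟨k, rfl⟩ := Nat.exists_eq_add_of_le' hk
  exact (List.append_inj h (hY.trans hZ.symm)).1

/-- Two commuting words are powers of a common word. -/
theorem exists_listPow_of_append_comm (C E : List α) (h : C ++ E = E ++ C) :
    ∃ (T : List α) (i j : ℕ), C = listPow T i ∧ E = listPow T j := by
  induction hn : C.length + E.length using Nat.strong_induction_on generalizing C E with
  | _ n ih =>
    rcases eq_or_ne C [] with rfl | hC
    · exact ⟨E, 0, 1, rfl, (listPow_one E).symm⟩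
    rcases eq_or_ne E [] with rfl | hE
    · exact ⟨C, 1, 0, (listPow_one C).symm, rfl⟩
    have hC' := List.length_pos_iff.2 hC
    have hE' := List.length_pos_iff.2 hE
    rcases List.append_eq_append_iff.1 h with ⟨F, h1, h2⟩ | ⟨F, h1, h2⟩
    · subst h1
      obtain ⟨T, i, j, hi, hj⟩ := ih (C.length + F.length) (by simp at hn; omega) C F h2 rfl
      exact ⟨T, i, i + j, hi, by rw [listPow_add, ← hi, ← hj]⟩
    · subst h1
      obtain ⟨T, i, j, hi, hj⟩ := ih (E.length + F.length) (by simp at hn; omega) E F h2 rfl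
      exact ⟨T, i + j, i, by rw [listPow_add, ← hi, ← hj], hi⟩

end ListPow

section CurlingNumber

variable {α : Type*}

theorem le_CN_iff {k : ℕ} (hk : 1 ≤ k) (S : List α) :
    k ≤ CN S ↔ ∃ Y : List α, Y ≠ [] ∧ listPow Y k <:+ S := by
  have hbdd : BddAbove {k | ∃ X Y : List α, Y ≠ [] ∧ S = X ++ listPow Y k} := by
    refine ⟨S.length, ?_⟩
    rintro j ⟨X, Y, hY, rfl⟩
    have := List.length_pos_iff.2 hY
    simp only [List.length_append, length_listPow]
    nlinarith
  constructor
  · intro h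
    have hne : {k | ∃ X Y : List α, Y ≠ [] ∧ S = X ++ listPow Y k}.Nonempty := by
      by_contra hne
      rw [Set.not_nonempty_iff_eq_empty] at hne
      rw [CN, hne] at h
      simp at h
      omega
    obtain ⟨X, Y, hY, hS⟩ := Nat.sSup_mem hne hbdd
    obtain ⟨d, hd⟩ := Nat.exists_eq_add_of_le' h
    rw [← CN, hd, listPow_add] at hS
    exact ⟨Y, hY, X ++ listPow Y d, by rw [hS, List.append_assoc]⟩
  · rintro ⟨Y, hY, X, hX⟩
    exact le_csSup hbdd ⟨X, Y, hY, hX.symm⟩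

theorem CN_le_length (S : List α) : CN S ≤ S.length := by
  rcases Nat.eq_zero_or_pos (CN S) with h | h
  · omega
  · obtain ⟨Y, hY, hs⟩ := (le_CN_iff h S).1 le_rfl
    have := hs.length_le
    rw [length_listPow] at this
    have := List.length_pos_iff.2 hY
    nlinarith

theorem one_le_CN {S : List α} (hS : S ≠ []) : 1 ≤ CN S :=
  (le_CN_iff le_rfl S).2 ⟨S, hS, by rw [listPow_one]⟩

theorem CN_mono {S T : List α} (h : S <:+ T) : CN S ≤ CN T := by
  rcases Nat.eq_zero_or_pos (CN S) with h0 | h0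
  · omega
  · obtain ⟨Y, hY, hs⟩ := (le_CN_iff h0 S).1 le_rfl
    exact (le_CN_iff h0 T).2 ⟨Y, hY, hs.trans h⟩

theorem properSuffix_iff_tail {S T : List α} (hS : S ≠ []) :
    ProperSuffix T S ↔ T <:+ S.tail := by
  obtain ⟨a, S, rfl⟩ := List.exists_cons_of_ne_nil hS
  rw [ProperSuffix, List.suffix_cons_iff]
  constructor
  · rintro ⟨rfl | h, hl⟩
    · simp at hl
    · exact h
  · intro h
    exact ⟨Or.inr h, by simpa [Nat.lt_succ_iff] using h.length_le⟩

theorem robust_iff {S : List α} (hS : S ≠ []) :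
    Robust S ↔ CN (listPow S (CN S + 1)).tail ≤ CN S := by
  have hne : listPow S (CN S + 1) ≠ [] := by simp [listPow, hS]
  simp only [Robust, properSuffix_iff_tail hne]
  exact ⟨fun h => h _ List.suffix_rfl, fun h T hT => (CN_mono hT).trans h⟩

/-- If a power of a primitive word `Y` ends in `k + 1` copies of a shorter nonempty word `Z`,
then `Y` itself already ends in `k` copies of `Z`. -/
theorem Primitive.listPow_suffix {Y Z : List α} {k l : ℕ} (hY : Primitive Y) (hZ : Z ≠ [])
    (hlen : Z.length < Y.length) (h : listPow Z (k + 1) <:+ listPow Y (l + 1)) :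
    listPow Z k <:+ Y := by
  have hYs : Y <:+ listPow Y (l + 1) := by rw [listPow_succ']; exact List.suffix_append _ _
  have hZs : listPow Z k <:+ listPow Z (k + 1) := List.suffix_append _ _
  rcases le_or_gt (listPow Z k).length Y.length with hle | hgt
  · exact List.suffix_of_suffix_length_le (hZs.trans h) hYs hle
  exfalso
  obtain ⟨B, hB⟩ := List.suffix_of_suffix_length_le hYs (hZs.trans h) hgt.le
  have hYZ : Y ++ Z <:+ listPow Y (l + 1) := by
    refine List.IsSuffix.trans ⟨B, ?_⟩ h
    rw [listPow_succ', ← hB, List.append_assoc]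
  have hl : 1 ≤ l := by
    rcases Nat.eq_zero_or_pos l with rfl | hl
    · have h1 := hYZ.length_le
      have := List.length_pos_iff.2 hZ
      rw [length_listPow, List.length_append] at h1
      omega
    · exact hl
  obtain ⟨l, rfl⟩ := Nat.exists_eq_add_of_le' hl
  have hYY : Y ++ Y <:+ listPow Y (l + 1 + 1) := by
    rw [listPow_succ', listPow_succ', List.append_assoc]; exact List.suffix_append _ _
  obtain ⟨C, hC⟩ := List.suffix_of_suffix_length_le hYZ hYY (by simp; omega)
  have hlenC : C.length + Z.length = Y.length := by
    have := congrArg List.length hC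
    simp at this
    omega
  rw [← List.append_assoc] at hC
  have hCY : C <+: Y := by
    refine List.prefix_of_prefix_length_le (l₃ := Y ++ Y) ⟨Y ++ Z, ?_⟩ (List.prefix_append _ _)
      (by omega)
    rw [← hC, List.append_assoc]
  obtain ⟨E, hE⟩ := hCY
  have hlenE : E.length = Z.length := by
    have := congrArg List.length hE
    simp at this
    omega
  have hCY' : C ++ (Y ++ Z) = C ++ ((E ++ C) ++ E) := by
    rw [← List.append_assoc, hC, ← hE]; simp
  have hEC := List.append_inj (List.append_cancel_left hCY') (by simp; omega)
  obtain ⟨T, i, j, hi, hj⟩ := exists_listPow_of_append_comm C E (by rw [hE, ← hEC.1])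
  refine hY.2 T (i + j) ?_ (by rw [listPow_add, ← hi, ← hj, hE])
  have hi0 : i ≠ 0 := by
    rintro rfl
    rw [hi] at hlenC
    simp [listPow] at hlenC
    omega
  have hj0 : j ≠ 0 := by
    rintro rfl
    have := List.length_pos_iff.2 hZ
    rw [hj] at hlenE
    simp [listPow] at hlenE
    omega
  omega

/-- The words with curling number at least `k` which lose this property when their first letter
is removed are the `k`-th powers of primitive words that either are robust with curling number
`k - 1`, or have curling number less than `k - 1`. -/
theorem le_CN_and_CN_tail_lt_iff (S : List α) (k : ℕ) :
    (k + 2 ≤ CN S ∧ CN S.tail < k + 2) ↔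
      ∃ Y : List α, listPow Y (k + 2) = S ∧ Primitive Y ∧ (CN Y = k + 1 ∧ Robust Y ∨ CN Y ≤ k) := by
  constructor
  · rintro ⟨h1, h2⟩
    obtain ⟨Y, hY, hs⟩ := (le_CN_iff (by omega) S).1 h1
    have hYS : listPow Y (k + 2) = S := by
      by_contra hne
      have hps : ProperSuffix (listPow Y (k + 2)) S :=
        ⟨hs, lt_of_le_of_ne hs.length_le fun h => hne (hs.eq_of_length h)⟩
      have hS : S ≠ [] := by rintro rfl; exact absurd hps.2 (by simp)
      exact absurd ((le_CN_iff (by omega) _).2 ⟨Y, hY, (properSuffix_iff_tail hS).1 hps⟩)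
        (not_le.2 h2)
    have hS : S ≠ [] := by rw [← hYS]; simp [listPow, hY]
    have hlen := length_listPow Y (k + 2)
    have hYpos := List.length_pos_iff.2 hY
    have hYtail : Y <:+ S.tail := by
      refine (properSuffix_iff_tail hS).1 ⟨?_, ?_⟩
      · rw [← hYS, listPow_succ']; exact List.suffix_append _ _
      · rw [← hYS, hlen]; nlinarith
    have hcn : CN Y < k + 2 := (CN_mono hYtail).trans_lt h2
    refine ⟨Y, hYS, ⟨hY, ?_⟩, ?_⟩
    · rintro T i hi rfl
      have hT : T ≠ [] := by
        rintro rfl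
        simp [length_listPow] at hYpos
      have hTpos := List.length_pos_iff.2 hT
      refine absurd ((le_CN_iff (by omega) _).2
        ⟨T, hT, (properSuffix_iff_tail hS).1 ⟨?_, ?_⟩⟩) (not_le.2 h2)
      · obtain ⟨d, rfl⟩ := Nat.exists_eq_add_of_le hi
        rw [← hYS, ← listPow_mul, show (2 + d) * (k + 2) = (1 + d) * (k + 2) + (k + 2) by ring,
          listPow_add T ((1 + d) * (k + 2))]
        exact List.suffix_append _ _
      · rw [← hYS, hlen, length_listPow, length_listPow]
        have : 2 * T.length ≤ i * T.length := Nat.mul_le_mul_right _ hi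
        nlinarith
    · rcases Nat.lt_or_ge k (CN Y) with h | h
      · have hk : CN Y = k + 1 := by omega
        refine Or.inl ⟨hk, (robust_iff hY).2 ?_⟩
        rw [hk, hYS]
        omega
      · exact Or.inr h
  · rintro ⟨Y, rfl, hY, h⟩
    have hne : listPow Y (k + 2) ≠ [] := by simp [listPow, hY.1]
    refine ⟨(le_CN_iff (by omega) _).2 ⟨Y, hY.1, List.suffix_rfl⟩, ?_⟩
    rcases h with ⟨hk, hr⟩ | hk
    · rw [robust_iff hY.1, hk] at hr
      exact Nat.lt_succ_of_le hr
    · by_contra! hc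
      obtain ⟨Z, hZ, hs⟩ := (le_CN_iff (by omega) _).1 hc
      obtain ⟨hs1, hs2⟩ := (properSuffix_iff_tail hne).2 hs
      rw [length_listPow, length_listPow] at hs2
      have := (le_CN_iff (by omega) _).2
        ⟨Z, hZ, hY.listPow_suffix (k := k + 1) (l := k + 1) hZ
          (lt_of_mul_lt_mul_left hs2 (Nat.zero_le _)) hs1⟩
      omega

end CurlingNumber

section Counting

theorem finite_length_eq_and (n : ℕ) (P : List Bool → Prop) :
    {S : List Bool | S.length = n ∧ P S}.Finite :=
  (List.finite_length_eq Bool n).subset fun _ h => h.1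

/-- The number of binary words of length `n` with curling number at least `k`. -/
noncomputable def geCount (n k : ℕ) : ℕ :=
  {S : List Bool | S.length = n ∧ k ≤ CN S}.ncard

/-- The number of binary words of length `n` with curling number at least `k` whose tail has
curling number less than `k`. -/
noncomputable def newCount (n k : ℕ) : ℕ :=
  {S : List Bool | S.length = n ∧ k ≤ CN S ∧ CN S.tail < k}.ncard

theorem ncard_length_eq_and_or (n : ℕ) (P Q : List Bool → Prop) (h : ∀ S, P S → ¬ Q S) :
    {S : List Bool | S.length = n ∧ (P S ∨ Q S)}.ncard =
      {S : List Bool | S.length = n ∧ P S}.ncard + {S : List Bool | S.length = n ∧ Q S}.ncard := by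
  rw [← Set.ncard_union_eq _ (finite_length_eq_and n P) (finite_length_eq_and n Q)]
  · congr 1
    ext S
    simp only [Set.mem_ofPred_eq, Set.mem_union]
    tauto
  · exact Set.disjoint_left.2 fun S hS hS' => h S hS.2 hS'.2

theorem geCount_eq (n k : ℕ) : geCount n k = cCount n k + geCount n (k + 1) := by
  rw [geCount, cCount, geCount, ← ncard_length_eq_and_or]
  · congr! 4
    omega
  · intro S h
    omega

theorem geCount_succ (n k : ℕ) : geCount (n + 1) k = 2 * geCount n k + newCount (n + 1) k := by
  have himage (b : Bool) : {S : List Bool | S.length = n + 1 ∧ (S.head? = some b ∧ k ≤ CN S.tail)}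
      = (fun S => b :: S) '' {S : List Bool | S.length = n ∧ k ≤ CN S} := by
    ext S
    cases S with
    | nil => simp
    | cons a S => simp; tauto
  have hcard (b : Bool) :
      {S : List Bool | S.length = n + 1 ∧ (S.head? = some b ∧ k ≤ CN S.tail)}.ncard
      = geCount n k := by
    rw [himage, Set.ncard_image_of_injective _ (List.cons_injective), geCount]
  have hsplit : geCount (n + 1) k = {S : List Bool | S.length = n + 1 ∧
      (((S.head? = some true ∧ k ≤ CN S.tail) ∨ (S.head? = some false ∧ k ≤ CN S.tail)) ∨
        (k ≤ CN S ∧ CN S.tail < k))}.ncard := by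
    rw [geCount]
    congr 1
    ext S
    have := CN_mono (List.tail_suffix S)
    rcases S with _ | ⟨_ | _, S⟩ <;> simp at this ⊢ <;> omega
  rw [hsplit, ncard_length_eq_and_or, ncard_length_eq_and_or, hcard, hcard, newCount]
  · ring
  · rintro S ⟨h, -⟩ ⟨h', -⟩
    simp [h] at h'
  · rintro S h ⟨-, h'⟩
    omega

theorem newCount_one (n : ℕ) : newCount (n + 2) 1 = 0 := by
  rw [newCount, Set.ncard_eq_zero (finite_length_eq_and _ _), Set.eq_empty_iff_forall_notMem]
  rintro S ⟨h1, -, h3⟩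
  have : S.tail ≠ [] := by
    rw [← List.length_pos_iff, List.length_tail]
    omega
  have := one_le_CN this
  omega

theorem ncard_primitive_CN_le (m k : ℕ) :
    {S : List Bool | S.length = m ∧ (Primitive S ∧ CN S ≤ k)}.ncard = qCount m k := by
  induction k with
  | zero =>
    rw [qCount, Set.ncard_eq_zero (finite_length_eq_and _ _) |>.2]
    · simp
    · rw [Set.eq_empty_iff_forall_notMem]
      rintro S ⟨-, h1, h2⟩
      have := one_le_CN h1.1
      omega
  | succ k ih =>
    rw [qCount, Finset.sum_Icc_succ_top (by omega), ← qCount, ← ih, pCount,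
      ← ncard_length_eq_and_or]
    · congr! 4 with S
      rw [Nat.le_succ_iff]
      tauto
    · intro S h h'
      omega

theorem newCount_eq (n k : ℕ) :
    newCount n (k + 2) = if k + 2 ∣ n then
      pCount' (n / (k + 2)) (k + 1) + qCount (n / (k + 2)) k else 0 := by
  rw [newCount]
  simp only [le_CN_and_CN_tail_lt_iff]
  split_ifs with hd
  · obtain ⟨m, rfl⟩ := hd
    have hinj : Set.InjOn (fun Y => listPow Y (k + 2)) {Y : List Bool | Y.length = m ∧
        ((CN Y = k + 1 ∧ Primitive Y ∧ Robust Y) ∨ (Primitive Y ∧ CN Y ≤ k))} :=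
      (listPow_injOn (by omega)).mono fun Y hY => hY.1
    rw [Nat.mul_div_cancel_left _ (by omega), ← ncard_primitive_CN_le, pCount',
      ← ncard_length_eq_and_or, ← hinj.ncard_image]
    · congr 1
      ext S
      constructor
      · rintro ⟨hl, Y, rfl, hY, h⟩
        rw [length_listPow] at hl
        exact ⟨Y, ⟨Nat.eq_of_mul_eq_mul_left (by omega) hl, by tauto⟩, rfl⟩
      · rintro ⟨Y, ⟨hl, h⟩, rfl⟩
        exact ⟨by rw [length_listPow, hl], Y, rfl, by tauto⟩
    · rintro S h h'
      omega
  · rw [Set.ncard_eq_zero (finite_length_eq_and _ _), Set.eq_empty_iff_forall_notMem]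
    rintro S ⟨rfl, Y, rfl, -⟩
    exact hd ⟨_, length_listPow _ _⟩

theorem geCount_of_lt {n k : ℕ} (h : n < k) : geCount n k = 0 := by
  rw [geCount, Set.ncard_eq_zero (finite_length_eq_and _ _), Set.eq_empty_iff_forall_notMem]
  rintro S ⟨rfl, hS⟩
  exact absurd (CN_le_length S) (by omega)

theorem geCount_self {k : ℕ} (hk : 1 ≤ k) : geCount k k = 2 := by
  have : {S : List Bool | S.length = k ∧ k ≤ CN S} =
      (fun Y => listPow Y k) '' {[true], [false]} := by
    ext S
    simp only [Set.mem_ofPred_eq, le_CN_iff hk]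
    constructor
    · rintro ⟨hl, Y, hY, hs⟩
      have h1 := hs.length_le
      rw [length_listPow, hl] at h1
      have h2 := List.length_pos_iff.2 hY
      have h3 : Y.length = 1 := by nlinarith
      refine ⟨Y, ?_, hs.eq_of_length (by rw [length_listPow, h3, hl, mul_one])⟩
      obtain ⟨_ | _, rfl⟩ := List.length_eq_one_iff.1 h3 <;> simp
    · rintro ⟨Y, hY, rfl⟩
      have h1 : Y.length = 1 := by rcases hY with rfl | rfl <;> rfl
      refine ⟨by simp [length_listPow, h1], Y, ?_, List.suffix_rfl⟩
      rw [← List.length_pos_iff, h1]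
      exact one_pos
  rw [geCount, this, Set.InjOn.ncard_image, Set.ncard_pair (by simp)]
  refine (listPow_injOn (m := 1) hk).mono ?_
  rintro Y (rfl | rfl) <;> rfl

theorem geCount_succ_self {k : ℕ} (hk : 1 ≤ k) : geCount (k + 1) k = 4 := by
  rw [geCount_succ, geCount_self hk]
  obtain ⟨_ | k, rfl⟩ := Nat.exists_eq_add_of_le' hk
  · rw [newCount_one]
  · rw [newCount_eq, if_neg]
    intro h
    have := Nat.le_of_dvd one_pos ((Nat.dvd_add_right (dvd_refl (k + 2))).1 h)
    omega

theorem pCount'_zero (m : ℕ) : pCount' m 0 = 0 := by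
  rw [pCount', Set.ncard_eq_zero (finite_length_eq_and _ _), Set.eq_empty_iff_forall_notMem]
  rintro S ⟨-, h, hp, -⟩
  have := one_le_CN hp.1
  omega

end Counting

/-- Recurrence for `c(n,k)`: `c(n,k) = 0` for `n ≤ k-1`, `c(n,k) = 2` for `n = k` and
`n = k+1`, and for `n ≥ k+2`,
`c(n,k) = 2 c(n-1,k) + [k ∣ n] (p'(n/k, k-1) + q(n/k, k-2))
        - [(k+1) ∣ n] (p'(n/(k+1), k) + q(n/(k+1), k-1))`. -/
theorem cCount_recurrence (n k : ℕ) (hn : 1 ≤ n) (hk : 1 ≤ k) :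
    (n ≤ k - 1 → cCount n k = 0) ∧
    (n = k ∨ n = k + 1 → cCount n k = 2) ∧
    (k + 2 ≤ n →
      (cCount n k : ℤ) = 2 * cCount (n - 1) k
        + (if k ∣ n then 1 else 0) *
            ((pCount' (n / k) (k - 1) : ℤ) + qCount (n / k) (k - 2))
        - (if (k + 1) ∣ n then 1 else 0) *
            ((pCount' (n / (k + 1)) k : ℤ) + qCount (n / (k + 1)) (k - 1))) := by
  refine ⟨fun h => ?_, ?_, fun h => ?_⟩
  · have := geCount_eq n k
    rw [geCount_of_lt (by omega)] at this
    omega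
  · rintro (rfl | rfl)
    · have := geCount_eq n n
      rw [geCount_self hk, geCount_of_lt (by omega)] at this
      omega
    · have := geCount_eq (k + 1) k
      rw [geCount_self hn, geCount_succ_self hk] at this
      omega
  · obtain ⟨n, rfl⟩ := Nat.exists_eq_add_of_le' (show 2 ≤ n by omega)
    obtain ⟨k, rfl⟩ := Nat.exists_eq_add_of_le' hk
    have hnew : newCount (n + 2) (k + 1) = if k + 1 ∣ n + 2 then
        pCount' ((n + 2) / (k + 1)) k + qCount ((n + 2) / (k + 1)) (k - 1) else 0 := by
      rcases k with _ | k
      · simp [newCount_one, qCount, pCount'_zero]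
      · exact newCount_eq _ _
    have h1 := geCount_eq (n + 2) (k + 1)
    have h2 := geCount_eq (n + 1) (k + 1)
    rw [geCount_succ (n + 1), geCount_succ (n + 1), hnew, newCount_eq] at h1
    simp only [Nat.add_sub_cancel, show n + 2 - 1 = n + 1 by omega,
      show k + 1 - 2 = k - 1 by omega, show k + 1 + 1 = k + 2 by omega,
      show n + 1 + 1 = n + 2 by omega] at h1 h2 ⊢
    split_ifs at h1 ⊢ <;> omega
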